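/- Fix finite sets Σ_C ⊆ N_C and Σ_R ⊆ N_R. For all natural numbers n, k ≥ 0, there exists a finite set E⁺_{n,k} of finite pointed interpretations such that for every concept C ∈ L(∀,∃,≥,⊓,⊤)[Σ_C,Σ_R] the following are equivalent: (1) C is equivalent to some concept D ∈ L(∀,∃,≥,⊓,⊤)[Σ_C,Σ_R] with dp(D) ≤ n and nr(D) ≤ k; (2) d ∈ C^I for every (I,d) ∈ E⁺_{n,k}. -/

import Mathlib

namespace DL

/-! ### Syntax of ALCQI concepts -/

/-- Roles: role names (indexed by ℕ) and inverse roles. -/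
inductive Role where
  | name : ℕ → Role
  | inv  : ℕ → Role
deriving DecidableEq

/-- ALCQI concept expressions. -/
inductive Concept where
  | atom : ℕ → Concept
  | top  : Concept
  | bot  : Concept
  | and  : Concept → Concept → Concept
  | or   : Concept → Concept → Concept
  | neg  : Concept → Concept
  | ex   : Role → Concept → Concept
  | all  : Role → Concept → Concept
  | atLeast : ℕ → Role → Concept → Concept
deriving DecidableEq

/-- The operators/constructors that a concept language may use. -/
inductive Op where
  | all | ex | ge | inv | and | or | top | bot | neg
deriving DecidableEq

/-! ### Interpretations and semantics -/

/-- An interpretation: a nonempty domain, interpretations of concept names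
and of role names. -/
structure Interp where
  Δ : Type
  dom_nonempty : Nonempty Δ
  atom : ℕ → Set Δ
  rel : ℕ → Δ → Δ → Prop

def Role.sem (I : Interp) : Role → (I.Δ → I.Δ → Prop)
  | .name R => I.rel R
  | .inv R  => fun d e => I.rel R e d

def Concept.sem (I : Interp) : Concept → Set I.Δ
  | .atom A => I.atom A
  | .top => Set.univ
  | .bot => ∅
  | .and C D => C.sem I ∩ D.sem I
  | .or C D => C.sem I ∪ D.sem I
  | .neg C => (C.sem I)ᶜ
  | .ex S C => {d | ∃ e, S.sem I d e ∧ e ∈ C.sem I}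
  | .all S C => {d | ∀ e, S.sem I d e → e ∈ C.sem I}
  | .atLeast k S C => {d | ∃ s : Finset I.Δ, s.card = k ∧ ∀ e ∈ s, S.sem I d e ∧ e ∈ C.sem I}

/-! ### Concept languages L(Os)[SC, SR] -/

def Role.inSig (Os : Finset Op) (SR : Finset ℕ) : Role → Prop
  | .name R => R ∈ SR
  | .inv R  => Op.inv ∈ Os ∧ R ∈ SR

/-- Membership of a concept in the language `L(Os)[SC, SR]`. -/
def Concept.inLang (Os : Finset Op) (SC SR : Finset ℕ) : Concept → Prop
  | .atom A => A ∈ SC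
  | .top => Op.top ∈ Os
  | .bot => Op.bot ∈ Os
  | .and C D => Op.and ∈ Os ∧ C.inLang Os SC SR ∧ D.inLang Os SC SR
  | .or C D => Op.or ∈ Os ∧ C.inLang Os SC SR ∧ D.inLang Os SC SR
  | .neg C => Op.neg ∈ Os ∧ C.inLang Os SC SR
  | .ex S C => Op.ex ∈ Os ∧ S.inSig Os SR ∧ C.inLang Os SC SR
  | .all S C => Op.all ∈ Os ∧ S.inSig Os SR ∧ C.inLang Os SC SR
  | .atLeast k S C => Op.ge ∈ Os ∧ 1 ≤ k ∧ S.inSig Os SR ∧ C.inLang Os SC SR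

/-! ### DL-Lite ontologies -/

/-- Basic concepts: concept names, ∃R and ∃R⁻. -/
inductive Basic where
  | atom : ℕ → Basic
  | ex : Role → Basic
deriving DecidableEq

def Basic.sem (I : Interp) : Basic → Set I.Δ
  | .atom A => I.atom A
  | .ex S => {d | ∃ e, S.sem I d e}

/-- A DL-Lite concept inclusion `B ⊑ C` where `C` is a basic concept
(`negated = false`) or a negated basic concept (`negated = true`). -/
structure CI where
  lhs : Basic
  rhs : Basic
  negated : Bool
deriving DecidableEq

def CI.sat (I : Interp) (ci : CI) : Prop :=
  if ci.negated then ci.lhs.sem I ⊆ (ci.rhs.sem I)ᶜ else ci.lhs.sem I ⊆ ci.rhs.sem I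

/-- A DL-Lite ontology: a finite set (list) of concept inclusions. -/
abbrev Ontology := List CI

def Interp.satO (I : Interp) (Ont : Ontology) : Prop := ∀ ci ∈ Ont, ci.sat I

/-! ### Pointed interpretations, examples, characterisations -/

structure PInterp where
  I : Interp
  pt : I.Δ

/-- A pointed interpretation is finite if its domain is finite. -/
def PInterp.finite (P : PInterp) : Prop := Finite P.I.Δ

/-- `C` fits a collection `(Epos, Eneg)` of labelled examples. -/
def Fits (C : Concept) (Epos Eneg : List PInterp) : Prop :=
  (∀ e ∈ Epos, e.pt ∈ C.sem e.I) ∧ (∀ e ∈ Eneg, e.pt ∉ C.sem e.I)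

/-- Equivalence of concepts. -/
def CEquiv (C D : Concept) : Prop := ∀ I : Interp, C.sem I = D.sem I

/-- Equivalence of concepts relative to an ontology. -/
def CEquivO (Ont : Ontology) (C D : Concept) : Prop :=
  ∀ I : Interp, I.satO Ont → C.sem I = D.sem I

/-- `⊨ C ⊑ D`. -/
def Subsumes (C D : Concept) : Prop := ∀ I : Interp, C.sem I ⊆ D.sem I

/-- `Ont ⊨ C ⊑ D`. -/
def SubsumesO (Ont : Ontology) (C D : Concept) : Prop :=
  ∀ I : Interp, I.satO Ont → C.sem I ⊆ D.sem I

/-- `(Epos, Eneg)` is a finite characterisation of `C` w.r.t. the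
concept language (predicate) `L`: all examples are finite, `C` fits,
and every fitting concept of `L` is equivalent to `C`. -/
def FinChar (L : Concept → Prop) (C : Concept) (Epos Eneg : List PInterp) : Prop :=
  (∀ e ∈ Epos ++ Eneg, e.finite) ∧
  Fits C Epos Eneg ∧
  ∀ D, L D → Fits D Epos Eneg → CEquiv C D

/-- Finite characterisation of `C` w.r.t. `L` under an ontology `Ont`:
all examples are finite and satisfy `Ont`, `C` fits, and every fitting
concept of `L` is equivalent to `C` relative to `Ont`. -/
def FinCharO (Ont : Ontology) (L : Concept → Prop) (C : Concept)
    (Epos Eneg : List PInterp) : Prop :=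
  (∀ e ∈ Epos ++ Eneg, e.finite ∧ e.I.satO Ont) ∧
  Fits C Epos Eneg ∧
  ∀ D, L D → Fits D Epos Eneg → CEquivO Ont C D

/-- `L(Os)` admits finite characterisations. -/
def AdmitsFinChar (Os : Finset Op) : Prop :=
  ∀ SC SR : Finset ℕ, ∀ C : Concept, C.inLang Os SC SR →
    ∃ Epos Eneg : List PInterp, FinChar (Concept.inLang Os SC SR) C Epos Eneg

/-- `L(Os)` admits finite characterisations under the ontology `Ont`. -/
def AdmitsFinCharO (Os : Finset Op) (Ont : Ontology) : Prop :=
  ∀ SC SR : Finset ℕ, ∀ C : Concept, C.inLang Os SC SR →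
    ∃ Epos Eneg : List PInterp, FinCharO Ont (Concept.inLang Os SC SR) C Epos Eneg

/-! ### Size, role depth, number restrictions -/

/-- Number of symbols of a concept expression (numbers in binary). -/
def Concept.size : Concept → ℕ
  | .atom _ => 1
  | .top => 1
  | .bot => 1
  | .and C D => C.size + D.size + 1
  | .or C D => C.size + D.size + 1
  | .neg C => C.size + 1
  | .ex _ C => C.size + 2
  | .all _ C => C.size + 2
  | .atLeast k _ C => C.size + 2 + Nat.size k

/-- Role depth of a concept. -/
def Concept.dp : Concept → ℕ
  | .atom _ => 0
  | .top => 0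
  | .bot => 0
  | .and C D => max C.dp D.dp
  | .or C D => max C.dp D.dp
  | .neg C => C.dp
  | .ex _ C => C.dp + 1
  | .all _ C => C.dp + 1
  | .atLeast _ _ C => C.dp + 1

/-- The largest number occurring in a number restriction of `C` (0 if none). -/
def Concept.nr : Concept → ℕ
  | .atom _ => 0
  | .top => 0
  | .bot => 0
  | .and C D => max C.nr D.nr
  | .or C D => max C.nr D.nr
  | .neg C => C.nr
  | .ex _ C => C.nr
  | .all _ C => C.nr
  | .atLeast k _ C => max k C.nr

/-- The operator set of `L(∀,∃,≥,⊓,⊤)`. -/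
def ALEQops : Finset Op := {Op.all, Op.ex, Op.ge, Op.and, Op.top}

/-- The edges of `layered`: each layer `i + 1` points to all of layer `i`, and layer `0` points to
both points of the tail when `b` holds. In the tail, `inr true` sees everything and `inr false`
sees nothing. -/
def layeredSucc (n m : ℕ) (b : Bool) :
    (Fin (n + 1) × Fin m) ⊕ Bool → (Fin (n + 1) × Fin m) ⊕ Bool → Prop
  | .inl p, .inl q => p.1.val = q.1.val + 1
  | .inl p, .inr _ => p.1.val = 0 ∧ b = true
  | .inr x, .inr _ => x = true
  | .inr _, .inl _ => False

/-- Layers `0, …, n` of `m` points satisfying all atoms, followed by a tail of two points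
satisfying none; all role names are interpreted by `layeredSucc`. -/
def layered (n m : ℕ) (b : Bool) : Interp where
  Δ := (Fin (n + 1) × Fin m) ⊕ Bool
  dom_nonempty := ⟨.inr true⟩
  atom _ := {x | x.isLeft}
  rel _ := layeredSucc n m b

lemma inSig_ALEQops {SR : Finset ℕ} {S : Role} (h : S.inSig ALEQops SR) :
    ∃ R, S = .name R := by
  cases S with
  | name R => exact ⟨R, rfl⟩
  | inv R => simp [Role.inSig, ALEQops] at h

lemma sem_atLeast_one (I : Interp) (S : Role) (C : Concept) :
    (Concept.atLeast 1 S C).sem I = (Concept.ex S C).sem I := by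
  ext d
  constructor
  · rintro ⟨s, hs, h⟩
    obtain ⟨e, rfl⟩ := Finset.card_eq_one.1 hs
    exact ⟨e, h e (by simp)⟩
  · rintro ⟨e, he⟩
    exact ⟨{e}, by simp, by simpa using he⟩

/-- A concept true at both points of the tail is trivial. -/
lemma cequiv_top_of_tail {SC SR : Finset ℕ} {n m : ℕ} {b : Bool} {C : Concept}
    (hC : C.inLang ALEQops SC SR)
    (h : ∀ x : Bool, (Sum.inr x : (layered n m b).Δ) ∈ C.sem (layered n m b)) :
    CEquiv C .top := by
  induction C with
  | atom A => exact absurd (h true) Bool.false_ne_true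
  | top => exact fun _ => rfl
  | bot => exact absurd hC (by simp [Concept.inLang, ALEQops])
  | or C D => exact absurd hC.1 (by decide)
  | neg C => exact absurd hC.1 (by decide)
  | and C D ihC ihD =>
    intro I
    simp only [Concept.sem]
    rw [ihC hC.2.1 (fun x => (h x).1) I, ihD hC.2.2 (fun x => (h x).2) I]
    simp [Concept.sem]
  | ex S C ih =>
    obtain ⟨R, rfl⟩ := inSig_ALEQops hC.2.1
    obtain ⟨e, he, -⟩ := h false
    rcases e with e | e
    · exact he.elim
    · exact absurd he Bool.false_ne_true
  | all S C ih =>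
    obtain ⟨R, rfl⟩ := inSig_ALEQops hC.2.1
    intro I
    simp only [Concept.sem]
    rw [ih hC.2.2 (fun x => h true (Sum.inr x) rfl) I]
    simp [Concept.sem]
  | atLeast k S C ih =>
    obtain ⟨R, rfl⟩ := inSig_ALEQops hC.2.2.1
    obtain ⟨s, hs, he⟩ := h false
    obtain ⟨e, hes⟩ := Finset.card_pos.1 (hs ▸ hC.2.1)
    replace he := (he e hes).1
    rcases e with e | e
    · exact he.elim
    · exact absurd he Bool.false_ne_true

/-- The points of layer `i` satisfy all concepts of depth at most `i` with numbers at most `m`. -/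
lemma layer_mem_sem {SC SR : Finset ℕ} {n m : ℕ} {b : Bool} (hm : 1 ≤ m) {C : Concept}
    (hC : C.inLang ALEQops SC SR) (hnr : C.nr ≤ m) (p : Fin (n + 1) × Fin m)
    (hdp : C.dp ≤ p.1.val) :
    (Sum.inl p : (layered n m b).Δ) ∈ C.sem (layered n m b) := by
  induction C generalizing p with
  | atom A => exact rfl
  | top => trivial
  | bot => exact absurd hC (by simp [Concept.inLang, ALEQops])
  | or C D => exact absurd hC.1 (by decide)
  | neg C => exact absurd hC.1 (by decide)
  | and C D ihC ihD =>
    simp only [Concept.nr, Concept.dp, max_le_iff] at hnr hdp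
    exact ⟨ihC hC.2.1 hnr.1 p hdp.1, ihD hC.2.2 hnr.2 p hdp.2⟩
  | ex S C ih =>
    obtain ⟨R, rfl⟩ := inSig_ALEQops hC.2.1
    simp only [Concept.nr, Concept.dp] at hnr hdp
    have hlt := p.1.isLt
    refine ⟨Sum.inl (⟨p.1.val - 1, by omega⟩, ⟨0, hm⟩), ?_, ih hC.2.2 hnr _ ?_⟩
    · change p.1.val = p.1.val - 1 + 1
      omega
    · change _ ≤ p.1.val - 1
      omega
  | all S C ih =>
    obtain ⟨R, rfl⟩ := inSig_ALEQops hC.2.1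
    simp only [Concept.nr, Concept.dp] at hnr hdp
    rintro (q | q) hq
    · change p.1.val = q.1.val + 1 at hq
      exact ih hC.2.2 hnr q (by omega)
    · have := hq.1
      omega
  | atLeast k S C ih =>
    obtain ⟨R, rfl⟩ := inSig_ALEQops hC.2.2.1
    simp only [Concept.nr, Concept.dp, max_le_iff] at hnr hdp
    have hlt := p.1.isLt
    let f : Fin k ↪ (layered n m b).Δ :=
      ⟨fun j => Sum.inl (⟨p.1.val - 1, by omega⟩, Fin.castLE hnr.1 j), fun _ _ h =>
        Fin.castLE_injective hnr.1 (congrArg Prod.snd (Sum.inl_injective h))⟩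
    refine ⟨Finset.univ.map f, (Finset.card_map f).trans (Finset.card_fin k), fun e he => ?_⟩
    obtain ⟨j, -, rfl⟩ := Finset.mem_map.1 he
    refine ⟨?_, ih hC.2.2.2 hnr.2 _ ?_⟩
    · change p.1.val = p.1.val - 1 + 1
      omega
    · change _ ≤ p.1.val - 1
      omega

/-- A set of successors of a point of layer `i + 1` has at most `m` elements. -/
lemma card_le_of_layeredSucc {n m i : ℕ} {b : Bool} {hi : i + 1 < n + 1} {j : Fin m}
    {s : Finset ((Fin (n + 1) × Fin m) ⊕ Bool)}
    (hs : ∀ e ∈ s, layeredSucc n m b (.inl (⟨i + 1, hi⟩, j)) e) : s.card ≤ m := by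
  let f : Fin m → (Fin (n + 1) × Fin m) ⊕ Bool := fun j => .inl (⟨i, by omega⟩, j)
  have hsub : s ⊆ Finset.univ.image f := by
    intro e he
    have h := hs e he
    rcases e with ⟨i', j'⟩ | e
    · refine Finset.mem_image.2 ⟨j', Finset.mem_univ _, ?_⟩
      have : i = i'.val := Nat.succ.inj h
      simp [f, this]
    · exact absurd h.1 (Nat.succ_ne_zero i)
  exact (Finset.card_le_card hsub).trans (Finset.card_image_le.trans (by simp))

lemma exists_cequiv_of_layer {SC SR : Finset ℕ} {n k : ℕ} {C : Concept}
    (hC : C.inLang ALEQops SC SR) (i : ℕ) (hi : i < n + 1)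
    (h : ∀ b, ∃ j : Fin (max k 1), (Sum.inl (⟨i, hi⟩, j) : (layered n (max k 1) b).Δ) ∈
      C.sem (layered n (max k 1) b)) :
    ∃ D : Concept, D.inLang ALEQops SC SR ∧ D.dp ≤ i ∧ D.nr ≤ k ∧ CEquiv C D := by
  induction C generalizing i with
  | atom A => exact ⟨.atom A, hC, Nat.zero_le _, Nat.zero_le _, fun _ => rfl⟩
  | top => exact ⟨.top, hC, Nat.zero_le _, Nat.zero_le _, fun _ => rfl⟩
  | bot => exact absurd hC (by simp [Concept.inLang, ALEQops])
  | or C D => exact absurd hC.1 (by decide)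
  | neg C => exact absurd hC.1 (by decide)
  | and C D ihC ihD =>
    obtain ⟨C', hC', hCd, hCn, hCe⟩ := ihC hC.2.1 i hi (fun b => (h b).imp fun _ hj => hj.1)
    obtain ⟨D', hD', hDd, hDn, hDe⟩ := ihD hC.2.2 i hi (fun b => (h b).imp fun _ hj => hj.2)
    exact ⟨.and C' D', ⟨hC.1, hC', hD'⟩, max_le hCd hDd, max_le hCn hDn,
      fun I => by simp only [Concept.sem, hCe I, hDe I]⟩
  | ex S C ih =>
    obtain ⟨R, rfl⟩ := inSig_ALEQops hC.2.1
    cases i with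
    | zero =>
      obtain ⟨j, e, he, -⟩ := h false
      rcases e with e | e
      · exact absurd he (Nat.succ_ne_zero _).symm
      · exact absurd he.2 (by decide)
    | succ i =>
      obtain ⟨C', hC', hd, hn, he⟩ := ih hC.2.2 i (by omega) fun b => by
        obtain ⟨j, e, hje, he⟩ := h b
        rcases e with ⟨i', j'⟩ | e
        · obtain rfl : i = i'.val := Nat.succ.inj hje
          exact ⟨j', he⟩
        · exact absurd hje.1 (Nat.succ_ne_zero i)
      exact ⟨.ex (.name R) C', ⟨hC.1, hC.2.1, hC'⟩, Nat.succ_le_succ hd, hn,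
        fun I => by simp only [Concept.sem, he I]⟩
  | all S C ih =>
    obtain ⟨R, rfl⟩ := inSig_ALEQops hC.2.1
    cases i with
    | zero =>
      obtain ⟨j, hj⟩ := h true
      have htop := cequiv_top_of_tail hC.2.2 fun x => hj (Sum.inr x) ⟨rfl, rfl⟩
      refine ⟨.top, by simp [Concept.inLang, ALEQops], le_rfl, Nat.zero_le _, fun I => ?_⟩
      simp [Concept.sem, htop I]
    | succ i =>
      obtain ⟨C', hC', hd, hn, he⟩ := ih hC.2.2 i (by omega) fun b => by
        obtain ⟨j, hj⟩ := h b
        exact ⟨j, hj _ rfl⟩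
      exact ⟨.all (.name R) C', ⟨hC.1, hC.2.1, hC'⟩, Nat.succ_le_succ hd, hn,
        fun I => by simp only [Concept.sem, he I]⟩
  | atLeast m S C ih =>
    obtain ⟨R, rfl⟩ := inSig_ALEQops hC.2.2.1
    cases i with
    | zero =>
      obtain ⟨j, s, hs, hall⟩ := h false
      obtain ⟨e, hes⟩ := Finset.card_pos.1 (hs ▸ hC.2.1)
      have he := (hall e hes).1
      rcases e with e | e
      · exact absurd he (Nat.succ_ne_zero _).symm
      · exact absurd he.2 (by decide)
    | succ i =>
      obtain ⟨C', hC', hd, hn, he⟩ := ih hC.2.2.2 i (by omega) fun b => by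
        obtain ⟨j, s, hs, hall⟩ := h b
        obtain ⟨e, hes⟩ := Finset.card_pos.1 (hs ▸ hC.2.1)
        obtain ⟨hje, he⟩ := hall e hes
        rcases e with ⟨i', j'⟩ | e
        · obtain rfl : i = i'.val := Nat.succ.inj hje
          exact ⟨j', he⟩
        · exact absurd hje.1 (Nat.succ_ne_zero i)
      obtain ⟨j, s, hs, hall⟩ := h true
      have hmk : m ≤ max k 1 := hs ▸ card_le_of_layeredSucc fun e hes => (hall e hes).1
      rcases le_or_gt m k with hle | hlt
      · exact ⟨.atLeast m (.name R) C', ⟨hC.1, hC.2.1, hC.2.2.1, hC'⟩, Nat.succ_le_succ hd,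
          max_le hle hn, fun I => by simp only [Concept.sem, he I]⟩
      · obtain rfl : m = 1 := by
          have := hC.2.1
          omega
        refine ⟨.ex (.name R) C', ⟨by decide, hC.2.2.1, hC'⟩, Nat.succ_le_succ hd, hn,
          fun I => ?_⟩
        rw [sem_atLeast_one]
        simp only [Concept.sem, he I]

/-- **Proposition (depth & number-restriction bounding positive examples)**:
for all `n, k` there is a finite set of finite positive examples `E⁺_{n,k}`
such that a concept `C ∈ L(∀,∃,≥,⊓,⊤)[SC,SR]` fits them all positively iff
`C` is equivalent to a concept of role depth at most `n` and maximum number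
restriction at most `k`. -/
theorem depth_bounding_examples (SC SR : Finset ℕ) (n k : ℕ) :
    ∃ E : List PInterp, (∀ e ∈ E, e.finite) ∧
      ∀ C : Concept, C.inLang ALEQops SC SR →
        ((∃ D : Concept, D.inLang ALEQops SC SR ∧ D.dp ≤ n ∧ D.nr ≤ k ∧ CEquiv C D)
          ↔ ∀ e ∈ E, e.pt ∈ C.sem e.I) := by
  let P : Bool → PInterp := fun b =>
    ⟨layered n (max k 1) b, Sum.inl (Fin.last n, ⟨0, by omega⟩)⟩
  refine ⟨[P false, P true], fun e he => ?_, fun C hC => ⟨?_, fun h => ?_⟩⟩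
  · have hfin (b : Bool) : (P b).finite :=
      inferInstanceAs (Finite ((Fin (n + 1) × Fin (max k 1)) ⊕ Bool))
    simp only [List.mem_cons, List.not_mem_nil, or_false] at he
    rcases he with rfl | rfl <;> exact hfin _
  · rintro ⟨D, hD, hdp, hnr, heq⟩ e he
    have hmem (b : Bool) : (P b).pt ∈ C.sem (P b).I := by
      rw [heq]
      exact layer_mem_sem (le_max_right k 1) hD (hnr.trans (le_max_left k 1)) _ hdp
    simp only [List.mem_cons, List.not_mem_nil, or_false] at he
    rcases he with rfl | rfl <;> exact hmem _
  · refine exists_cequiv_of_layer hC n n.lt_succ_self fun b => ⟨⟨0, by omega⟩, ?_⟩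
    cases b
    · exact h (P false) (by simp)
    · exact h (P true) (by simp)

end DL
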